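/- Let Λ = (W_j, Λ_j, v_j) be a g-fusion frame for H with canonical dual ~Λ = (~W_j, ~Λ_j, v_j), where ~W_j = S_Λ^{-1} W_j and ~Λ_j = Λ_j π_{W_j} S_Λ^{-1}, and let j₀ ∈ J with v_{j₀} = 1. If there exists f₀ ∈ H_{j₀} with f₀ ≠ 0 such that π_{W_{j₀}} Λ_{j₀}* ~Λ_{j₀} π_{~W_{j₀}} f₀ = f₀, then the family (W_j, Λ_j)_{j ≠ j₀} is not gf-complete in H. -/

import Mathlib

noncomputable section

open ContinuousLinearMap Submodule Set

variable {H : Type*} [NormedAddCommGroup H] [InnerProductSpace ℂ H] [CompleteSpace H]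

/-- The orthogonal projection onto a (complete, i.e. closed) subspace `K` of `H`,
viewed as a continuous endomorphism of `H`. -/
def gfP (K : Submodule ℂ H) [CompleteSpace K] : H →L[ℂ] H :=
  K.subtypeL.comp (orthogonalProjection K)

/-- The orthogonal projection onto the topological closure of a subspace `K` of `H`. -/
def gfPc (K : Submodule ℂ H) : H →L[ℂ] H :=
  haveI : CompleteSpace K.topologicalClosure :=
    K.isClosed_topologicalClosure.completeSpace_coe
  (K.topologicalClosure).subtypeL.comp (orthogonalProjection K.topologicalClosure)

theorem gfP_eq_starProjection (K : Submodule ℂ H) [CompleteSpace K] :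
    gfP K = K.starProjection := rfl

theorem inner_gfP_left (K : Submodule ℂ H) [CompleteSpace K] (x y : H) :
    inner ℂ (gfP K x) y = inner ℂ x (gfP K y) := by
  rw [gfP_eq_starProjection]
  exact Submodule.inner_starProjection_left_eq_right K x y

theorem inner_gfP_adjoint_right {G : Type*} [NormedAddCommGroup G] [InnerProductSpace ℂ G]
    [CompleteSpace G] (K : Submodule ℂ H) [CompleteSpace K] (T : H →L[ℂ] G) (x : H) (y : G) :
    inner ℂ x (gfP K (ContinuousLinearMap.adjoint T y)) = inner ℂ (T (gfP K x)) y := by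
  rw [← inner_gfP_left, ContinuousLinearMap.adjoint_inner_right]

theorem inner_sub_gfPc (K : Submodule ℂ H) (f : H) {w : H} (hw : w ∈ K) :
    inner ℂ (f - gfPc K f) w = 0 := by
  have : CompleteSpace K.topologicalClosure :=
    K.isClosed_topologicalClosure.completeSpace_coe
  exact Submodule.starProjection_inner_eq_zero (K := K.topologicalClosure) f w
    (K.le_topologicalClosure hw)

/-- A symmetric operator `T` satisfies `π_W T π_{T W} = π_W T`. -/
theorem gfP_comp_gfPc_map (W : Submodule ℂ H) [CompleteSpace W] (T : H →L[ℂ] H)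
    (hT : ∀ x y : H, inner ℂ (T x) y = inner ℂ x (T y)) (f : H) :
    gfP W (T (gfPc (W.map (T : H →ₗ[ℂ] H)) f)) = gfP W (T f) := by
  have h0 : gfP W (T (f - gfPc (W.map (T : H →ₗ[ℂ] H)) f)) = 0 := by
    rw [gfP_eq_starProjection, Submodule.starProjection_apply_eq_zero_iff,
      Submodule.mem_orthogonal']
    intro w hw
    rw [hT]
    exact inner_sub_gfPc _ f (Submodule.mem_map_of_mem hw)
  rw [map_sub, map_sub, sub_eq_zero] at h0
  exact h0.symm

/-- An operator given as a pointwise sum of symmetric operators is symmetric. -/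
theorem inner_left_eq_right_of_hasSum {ι : Type*} {T : ι → H → H} {S : H → H}
    (hT : ∀ j x y, inner ℂ (T j x) y = inner ℂ x (T j y))
    (hS : ∀ f, HasSum (fun j => T j f) (S f)) (x y : H) :
    inner ℂ (S x) y = inner ℂ x (S y) := by
  have h1 : HasSum (fun j => inner ℂ x (T j y)) (inner ℂ x (S y)) :=
    (hS y).mapL (innerSL ℂ x)
  have h2 : HasSum (fun j => inner ℂ y (T j x)) (inner ℂ y (S x)) :=
    (hS x).mapL (innerSL ℂ y)
  have h3 := h2.map (starRingEnd ℂ) Complex.continuous_conj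
  simp only [Function.comp_def, inner_conj_symm, hT] at h3
  exact h3.unique h1

theorem eq_zero_of_hasSum_eq_single {ι : Type*} {a : ι → ℝ} {j₀ : ι} (ha : ∀ j, 0 ≤ a j)
    (hs : HasSum a (a j₀)) {j : ι} (hj : j ≠ j₀) : a j = 0 := by
  classical
  have h := sum_le_hasSum {j, j₀} (fun i _ => ha i) hs
  rw [Finset.sum_pair hj] at h
  linarith [ha j]

theorem topologicalClosure_span_ne_top {s : Set H} {g : H} (hg : g ≠ 0)
    (hs : ∀ x ∈ s, inner ℂ g x = 0) : (Submodule.span ℂ s).topologicalClosure ≠ ⊤ := by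
  intro htop
  rw [Submodule.topologicalClosure_eq_top_iff] at htop
  refine hg ((Submodule.mem_bot ℂ).1 (htop ▸ ?_))
  have hle : Submodule.span ℂ s ≤ (ℂ ∙ g)ᗮ :=
    Submodule.span_le.2 fun x hx => Submodule.mem_orthogonal_singleton_iff_inner_right.2 (hs x hx)
  exact Submodule.mem_orthogonal' _ _ |>.2 fun x hx =>
    Submodule.mem_orthogonal_singleton_iff_inner_right.1 (hle hx)

/-- Let `(W j, Λ j, v j)` be a g-fusion frame for `H` with canonical dual
`(W̃ j, Λ̃ j, v j)` (`W̃ j = S⁻¹ W j`, `Λ̃ j = Λ j ∘ π_{W j} ∘ S⁻¹`), let `j₀ ∈ J` with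
`v j₀ = 1`. If some `f₀ ≠ 0` satisfies (note: `f₀` must lie in `H` for the stated
composition `π_{W j₀} ∘ (Λ j₀)* ∘ Λ̃ j₀ ∘ π_{W̃ j₀} : H → H` to typecheck; the paper's
"f₀ ∈ H_{j₀}" is a typo)
`π_{W j₀} ((Λ j₀)* (Λ̃ j₀ (π_{W̃ j₀} f₀))) = f₀`, then `(W j, Λ j)_{j ≠ j₀}` is not
gf-complete in `H`. -/
theorem stmt15 {ι : Type*} [Countable ι] {G : ι → Type*}
    [∀ j, NormedAddCommGroup (G j)] [∀ j, InnerProductSpace ℂ (G j)] [∀ j, CompleteSpace (G j)]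
    (W : ι → Submodule ℂ H) [∀ j, CompleteSpace (W j)]
    (Λ : ∀ j, H →L[ℂ] G j) (v : ι → ℝ) (hv : ∀ j, 0 < v j)
    (A B : ℝ) (hA : 0 < A) (hAB : A ≤ B)
    (hframe : ∀ f : H, Summable (fun j => (v j) ^ 2 * ‖Λ j (gfP (W j) f)‖ ^ 2) ∧
      A * ‖f‖ ^ 2 ≤ ∑' j, (v j) ^ 2 * ‖Λ j (gfP (W j) f)‖ ^ 2 ∧
      ∑' j, (v j) ^ 2 * ‖Λ j (gfP (W j) f)‖ ^ 2 ≤ B * ‖f‖ ^ 2)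
    (S Sinv : H →L[ℂ] H)
    (hS : ∀ f : H,
      HasSum (fun j =>
        (v j) ^ 2 • gfP (W j) (ContinuousLinearMap.adjoint (Λ j) (Λ j (gfP (W j) f)))) (S f))
    (hS1 : ∀ f : H, S (Sinv f) = f) (hS2 : ∀ f : H, Sinv (S f) = f)
    (Λd : ∀ j, H →L[ℂ] G j) (hΛd : ∀ j, Λd j = ((Λ j).comp (gfP (W j))).comp Sinv)
    (j₀ : ι) (hv₀ : v j₀ = 1) (f₀ : H) (hf₀ : f₀ ≠ 0)
    (h : gfP (W j₀) (ContinuousLinearMap.adjoint (Λ j₀)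
      (Λd j₀ (gfPc ((W j₀).map (Sinv : H →ₗ[ℂ] H)) f₀))) = f₀) :
    ¬ ((Submodule.span ℂ
        (⋃ j, ⋃ _ : j ≠ j₀, Set.range fun x : G j =>
          gfP (W j) (ContinuousLinearMap.adjoint (Λ j) x))).topologicalClosure = ⊤) := by
  have hSsymm : ∀ x y : H, inner ℂ (S x) y = inner ℂ x (S y) := by
    refine inner_left_eq_right_of_hasSum (fun j x y => ?_) hS
    rw [inner_smul_right_eq_smul, inner_smul_left_eq_smul, inner_gfP_adjoint_right,
      inner_gfP_left, ContinuousLinearMap.adjoint_inner_left]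
  have hSinv : ∀ x y : H, inner ℂ (Sinv x) y = inner ℂ x (Sinv y) := fun x y => by
    rw [← hS1 y, ← hSsymm, hS1, hS2]
  set g := Sinv f₀ with hg
  have hg0 : g ≠ 0 := fun h0 => hf₀ (by rw [← hS1 f₀, ← hg, h0, map_zero])
  rw [hΛd] at h
  simp only [ContinuousLinearMap.comp_apply] at h
  rw [gfP_comp_gfPc_map (W j₀) Sinv hSinv f₀, ← hg] at h
  have hsum : HasSum (fun j => v j ^ 2 * ‖Λ j (gfP (W j) g)‖ ^ 2)
      (v j₀ ^ 2 * ‖Λ j₀ (gfP (W j₀) g)‖ ^ 2) := by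
    have h1 := ((hS g).mapL (innerSL ℂ g)).mapL Complex.reCLM
    have h2 : S g = f₀ := hS1 f₀
    rw [h2, ← h] at h1
    simp only [innerSL_apply_apply, inner_smul_right_eq_smul, inner_gfP_adjoint_right,
      inner_self_eq_norm_sq_to_K, map_smul, smul_eq_mul, Complex.reCLM_apply] at h1
    rw [hv₀, one_pow, one_mul]
    exact_mod_cast h1
  refine topologicalClosure_span_ne_top hg0 fun x hx => ?_
  simp only [Set.mem_iUnion, Set.mem_range] at hx
  obtain ⟨j, hj, y, rfl⟩ := hx
  have hz := eq_zero_of_hasSum_eq_single (a := fun j => v j ^ 2 * ‖Λ j (gfP (W j) g)‖ ^ 2)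
    (fun j => by positivity) hsum hj
  have hz' : Λ j (gfP (W j) g) = 0 := by
    simpa [(hv j).ne'] using hz
  rw [inner_gfP_adjoint_right, hz', inner_zero_left]
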